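/- Let K be a field, n ≥ 3, and let S_n be the monoid presented by generators a_1, …, a_n and relations a_1 a_2 ⋯ a_n = a_{σ(1)} ⋯ a_{σ(n)} for σ in the cyclic group generated by the n-cycle. Then the monoid algebra K[S_n] is a domain: it has no nonzero zero divisors. -/

import Mathlib

/-- The word `a_{σ(1)} a_{σ(2)} ⋯ a_{σ(n)}` in the free monoid on `n` generators. -/
def permWord (n : ℕ) (σ : Equiv.Perm (Fin n)) : FreeMonoid (Fin n) :=
  ((List.finRange n).map fun i => FreeMonoid.of (σ i)).prod

/-- The defining relations `a_1 a_2 ⋯ a_n = a_{σ(1)} a_{σ(2)} ⋯ a_{σ(n)}`, where `σ` runs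
through the cyclic subgroup of `Sym_n` generated by the `n`-cycle `(1,2,…,n)` (i.e. `finRotate n`). -/
def cycRel (n : ℕ) : FreeMonoid (Fin n) → FreeMonoid (Fin n) → Prop :=
  fun x y => x = permWord n 1 ∧ ∃ k : ℕ, y = permWord n (finRotate n ^ k)

/-- The monoid `S_n` presented by generators `a_1, …, a_n` and the above relations. -/
def Scyc (n : ℕ) : Type := (conGen (cycRel n)).Quotient

instance (n : ℕ) : Monoid (Scyc n) := Con.monoid _

/-- The generator `a_i` of `S_n`. -/
def agen {n : ℕ} (i : Fin n) : Scyc n := (conGen (cycRel n)).mk' (FreeMonoid.of i)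

/-- The element `z = a_1 a_2 ⋯ a_n` of `S_n`. -/
def zc (n : ℕ) : Scyc n := ((List.finRange n).map agen).prod

/-! ### Unique products in free groups -/

theorem exists_additive_ne_zero_of_isFreeGroup {G : Type*} [Group G] (H : Subgroup G)
    [IsFreeGroup H] (hH : H ≠ ⊥) :
    ∃ φ : G → ℤ, (∀ x ∈ H, ∀ y ∈ H, φ (x * y) = φ x + φ y) ∧ ∃ x ∈ H, φ x ≠ 0 := by
  classical
  obtain ⟨ι, ⟨b⟩⟩ := IsFreeGroup.nonempty_basis (G := H)
  have hι : Nonempty ι := by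
    by_contra hι
    rw [not_nonempty_iff] at hι
    have := b.repr.toEquiv.subsingleton
    exact hH H.eq_bot_of_subsingleton
  obtain ⟨i⟩ := hι
  let f : H →* Multiplicative ℤ := b.lift fun _ => Multiplicative.ofAdd 1
  refine ⟨fun x => if h : x ∈ H then (f ⟨x, h⟩).toAdd else 0, fun x hx y hy => ?_,
    b i, (b i).2, ?_⟩
  · simp only [hx, hy, mul_mem hx hy, dif_pos]
    rw [← toAdd_mul, ← map_mul]
    rfl
  · have : f (b i) = Multiplicative.ofAdd 1 := by simp [f]
    simp [this]

theorem FreeGroup.exists_uniqueMul {X : Type*} (k : ℕ) (A B : Finset (FreeGroup X))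
    (hA : A.Nonempty) (hB : B.Nonempty) (hk : A.card + B.card ≤ k) :
    ∃ a ∈ A, ∃ b ∈ B, UniqueMul A B a b := by
  classical
  induction k generalizing A B with
  | zero => simp_all
  | succ k ih =>
    obtain ⟨a₀, ha₀⟩ := id hA
    obtain ⟨b₀, hb₀⟩ := id hB
    set T : Set (FreeGroup X) := (fun a => a₀⁻¹ * a) '' A ∪ (fun b => b * b₀⁻¹) '' B with hT
    by_cases hH : Subgroup.closure T = ⊥
    · rw [Subgroup.closure_eq_bot_iff] at hH
      refine ⟨a₀, ha₀, b₀, hb₀, fun a b ha hb _ => ⟨?_, ?_⟩⟩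
      · have : a₀⁻¹ * a = 1 := hH (Or.inl ⟨a, ha, rfl⟩)
        rwa [inv_mul_eq_one, eq_comm] at this
      · have : b * b₀⁻¹ = 1 := hH (Or.inr ⟨b, hb, rfl⟩)
        rwa [mul_inv_eq_one] at this
    obtain ⟨φ, hφ, x, hx, hx0⟩ := exists_additive_ne_zero_of_isFreeGroup _ hH
    have hmA : ∀ a ∈ A, a₀⁻¹ * a ∈ Subgroup.closure T := fun a ha =>
      Subgroup.subset_closure (Or.inl ⟨a, ha, rfl⟩)
    have hmB : ∀ b ∈ B, b * b₀⁻¹ ∈ Subgroup.closure T := fun b hb =>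
      Subgroup.subset_closure (Or.inr ⟨b, hb, rfl⟩)
    have h1 : φ 1 = 0 := by
      have := hφ 1 (one_mem _) 1 (one_mem _)
      rw [mul_one] at this
      omega
    have hne : ∃ t ∈ T, φ t ≠ 0 := by
      by_contra! hall
      refine hx0 ?_
      induction hx using Subgroup.closure_induction with
      | mem x hx => exact hall x hx
      | one => exact h1
      | mul x y hx hy ihx ihy =>
        rw [hφ x hx y hy]
        by_contra hne
        rcases eq_or_ne (φ x) 0 with h | h
        · rcases eq_or_ne (φ y) 0 with h' | h'
          · omega
          · exact h' (ihy h')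
        · exact h (ihx h)
      | inv x hx ihx =>
        have := hφ x hx _ (inv_mem hx)
        rw [mul_inv_cancel, h1] at this
        rcases eq_or_ne (φ x) 0 with h | h
        · omega
        · exact absurd (ihx h) h
    obtain ⟨a₁, ha₁, hmaxA⟩ := A.exists_max_image (fun a => φ (a₀⁻¹ * a)) hA
    obtain ⟨b₁, hb₁, hmaxB⟩ := B.exists_max_image (fun b => φ (b * b₀⁻¹)) hB
    set A' := A.filter fun a => φ (a₀⁻¹ * a) = φ (a₀⁻¹ * a₁) with hA'
    set B' := B.filter fun b => φ (b * b₀⁻¹) = φ (b₁ * b₀⁻¹) with hB'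
    have hAle : A'.card ≤ A.card := Finset.card_filter_le _ _
    have hBle : B'.card ≤ B.card := Finset.card_filter_le _ _
    have hlt : A'.card + B'.card < A.card + B.card := by
      by_contra hge
      have eA : A' = A := Finset.eq_of_subset_of_card_le (Finset.filter_subset _ _) (by omega)
      have eB : B' = B := Finset.eq_of_subset_of_card_le (Finset.filter_subset _ _) (by omega)
      rw [hA', Finset.filter_eq_self] at eA
      rw [hB', Finset.filter_eq_self] at eB
      obtain ⟨t, ⟨a, ha, rfl⟩ | ⟨b, hb, rfl⟩, ht⟩ := hne
      · have h2 := eA a₀ ha₀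
        rw [inv_mul_cancel, h1] at h2
        exact ht ((eA a ha).trans h2.symm)
      · have h2 := eB b₀ hb₀
        rw [mul_inv_cancel, h1] at h2
        exact ht ((eB b hb).trans h2.symm)
    obtain ⟨a, ha, b, hb, hu⟩ := ih A' B' ⟨a₁, by simp [hA', ha₁]⟩ ⟨b₁, by simp [hB', hb₁]⟩
      (by omega)
    simp only [hA', hB', Finset.mem_filter] at ha hb
    refine ⟨a, ha.1, b, hb.1, fun c d hc hd he => ?_⟩
    have e1 := hφ _ (hmA c hc) _ (hmB d hd)
    have e2 := hφ _ (hmA a ha.1) _ (hmB b hb.1)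
    have e3 : a₀⁻¹ * c * (d * b₀⁻¹) = a₀⁻¹ * a * (b * b₀⁻¹) := by
      simp only [mul_assoc]
      rw [← mul_assoc c, he]
      simp only [mul_assoc]
    rw [e3, e2] at e1
    have m1 := hmaxA c hc
    have m2 := hmaxB d hd
    have := ha.2
    have := hb.2
    refine hu ?_ ?_ he
    · simp only [hA', Finset.mem_filter]
      exact ⟨hc, by omega⟩
    · simp only [hB', Finset.mem_filter]
      exact ⟨hd, by omega⟩

instance FreeGroup.instUniqueProds {X : Type*} : UniqueProds (FreeGroup X) where
  uniqueMul_of_nonempty hA hB := FreeGroup.exists_uniqueMul _ _ _ hA hB le_rfl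

/-! ### Rotations of the word `a_1 ⋯ a_n` -/

theorem map_finRotate_finRange (n : ℕ) :
    (List.finRange n).map (finRotate n) = (List.finRange n).rotate 1 := by
  cases n with
  | zero => rfl
  | succ m =>
    conv_lhs => rw [List.finRange_succ_last]
    conv_rhs => rw [List.finRange_succ]
    simp [Function.comp_def]

theorem map_finRotate_pow_finRange (n k : ℕ) :
    (List.finRange n).map (finRotate n ^ k : Equiv.Perm (Fin n)) = (List.finRange n).rotate k := by
  induction k with
  | zero => simp
  | succ k ih =>
    rw [← List.rotate_rotate, ← ih, ← List.map_rotate, ← map_finRotate_finRange, List.map_map,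
      pow_succ]
    rfl

theorem permWord_eq_ofList (n : ℕ) (σ : Equiv.Perm (Fin n)) :
    permWord n σ = FreeMonoid.ofList ((List.finRange n).map σ) := by
  unfold permWord
  induction List.finRange n with
  | nil => rfl
  | cons a l ih => simp [ih, FreeMonoid.ofList_cons]

theorem List.IsRotated.append_cancel_left_of_nodup {α : Type*} {s t t' l : List α}
    (hl : l.Nodup) (hs : s ≠ []) (h : (t ++ s) ~r l) (h' : (s ++ t') ~r l) : t = t' := by
  have h1 : (s ++ t) ~r (s ++ t') := (List.isRotated_append.trans h).trans h'.symm
  have hnd : (s ++ t).Nodup := (List.isRotated_append.trans h).nodup_iff.2 hl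
  obtain ⟨k, hk⟩ := h1
  have hk' : (s ++ t).rotate (k % (s ++ t).length) = s ++ t' := by rw [List.rotate_mod, hk]
  have hpos : 0 < (s ++ t).length := by
    rw [List.length_append]
    have := List.length_pos_iff.2 hs
    omega
  have hlt := Nat.mod_lt k hpos
  have hhead := List.head?_rotate hlt
  rw [hk', List.head?_append_of_ne_nil _ hs] at hhead
  have h0 : (s ++ t)[0]? = s.head? := by
    rw [← List.head?_eq_getElem?, List.head?_append_of_ne_nil _ hs]
  rw [← h0, List.getElem?_eq_getElem hpos, List.getElem?_eq_getElem hlt, Option.some.injEq,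
    hnd.getElem_inj_iff] at hhead
  rw [← hhead, List.rotate_zero] at hk'
  exact List.append_cancel_left hk'

/-! ### Words in `S_n` and cancellation of the central element -/

namespace Scyc

variable {n : ℕ}

/-- The element of `S_n` represented by a word. -/
def word (l : List (Fin n)) : Scyc n := (l.map agen).prod

theorem word_append (l l' : List (Fin n)) : word (l ++ l') = word l * word l' := by
  simp [word]

theorem mk_eq_word (x : FreeMonoid (Fin n)) :
    (conGen (cycRel n)).mk' x = word x.toList := by
  induction x using FreeMonoid.inductionOn' with
  | one => rfl
  | of_mul a x ih =>
    rw [map_mul, ih]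
    exact (List.prod_cons (a := agen a) (l := x.toList.map agen)).symm

theorem word_surjective : Function.Surjective (word (n := n)) := fun x => by
  obtain ⟨y, rfl⟩ := Con.mk'_surjective (c := conGen (cycRel n)) x
  exact ⟨_, (mk_eq_word y).symm⟩

theorem word_eq_zc {r : List (Fin n)} (hr : r ~r List.finRange n) : word r = zc n := by
  obtain ⟨k, rfl⟩ := hr.symm
  have h : conGen (cycRel n) (permWord n 1) (permWord n (finRotate n ^ k)) :=
    ConGen.Rel.of _ _ ⟨rfl, k, rfl⟩
  have h2 := (Con.eq _).2 h
  have h3 : (conGen (cycRel n)).mk' (permWord n 1) =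
    (conGen (cycRel n)).mk' (permWord n (finRotate n ^ k)) := h2
  rw [mk_eq_word, mk_eq_word, permWord_eq_ofList, permWord_eq_ofList,
    map_finRotate_pow_finRange] at h3
  simp only [FreeMonoid.toList_ofList, Equiv.Perm.coe_one, List.map_id] at h3
  exact h3.symm

theorem exists_isRotated_cons (i : Fin n) : ∃ t, (i :: t) ~r List.finRange n := by
  obtain ⟨s, t, h⟩ := List.append_of_mem (List.mem_finRange i)
  exact ⟨t ++ s, by rw [h]; exact List.isRotated_append (l := i :: t)⟩

theorem exists_inverse_mod_zc (i : Fin n) : ∃ t : Scyc n, agen i * t = zc n ∧ t * agen i = zc n := by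
  obtain ⟨t, ht⟩ := exists_isRotated_cons i
  refine ⟨word t, ?_, ?_⟩
  · rw [← word_eq_zc ht]
    simp [word]
  · rw [← word_eq_zc ((List.isRotated_concat i t).trans ht)]
    simp [word]

theorem zc_commute (x : Scyc n) : Commute (zc n) x := by
  obtain ⟨l, rfl⟩ := word_surjective x
  refine Commute.list_prod_right _ _ fun y hy => ?_
  obtain ⟨i, -, rfl⟩ := List.mem_map.1 hy
  obtain ⟨t, h1, h2⟩ := exists_inverse_mod_zc i
  change zc n * agen i = agen i * zc n
  conv_lhs => rw [← h1, mul_assoc, h2]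

theorem word_eq_of_append_eq_of_le {p r q p' r' q' : List (Fin n)} (hr : r ~r List.finRange n)
    (hr' : r' ~r List.finRange n) (h : p ++ r ++ q = p' ++ r' ++ q') (hle : p.length ≤ p'.length) :
    word (p ++ q) = word (p' ++ q') := by
  rw [List.append_assoc, List.append_assoc] at h
  obtain ⟨t, rfl⟩ : p <+: p' := List.prefix_of_prefix_length_le ⟨_, h⟩ ⟨_, rfl⟩ hle
  rw [List.append_assoc, List.append_cancel_left_eq] at h
  rcases le_or_gt r.length t.length with hlen | hlen
  · obtain ⟨s, rfl⟩ : r <+: t := List.prefix_of_prefix_length_le ⟨_, h⟩ ⟨_, rfl⟩ hlen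
    rw [List.append_assoc, List.append_cancel_left_eq] at h
    subst h
    simp only [word_append, word_eq_zc hr, word_eq_zc hr', mul_assoc]
    rw [← mul_assoc (word s), ← (zc_commute (word s)).eq, mul_assoc]
  · obtain ⟨s, rfl⟩ : t <+: r := List.prefix_of_prefix_length_le ⟨_, h.symm⟩ ⟨_, rfl⟩ hlen.le
    rw [List.append_assoc, List.append_cancel_left_eq] at h
    have hs : s ≠ [] := by
      rintro rfl
      simp at hlen
    have hl : s.length ≤ r'.length := by
      have h1 := hr.perm.length_eq
      have h2 := hr'.perm.length_eq
      rw [List.length_append] at h1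
      omega
    obtain ⟨t', rfl⟩ : s <+: r' := List.prefix_of_prefix_length_le ⟨_, h⟩ ⟨_, rfl⟩ hl
    rw [List.append_assoc, List.append_cancel_left_eq] at h
    obtain rfl := List.IsRotated.append_cancel_left_of_nodup (List.nodup_finRange n) hs hr hr'
    rw [h, List.append_assoc]

theorem word_eq_of_append_eq {p r q p' r' q' : List (Fin n)} (hr : r ~r List.finRange n)
    (hr' : r' ~r List.finRange n) (h : p ++ r ++ q = p' ++ r' ++ q') :
    word (p ++ q) = word (p' ++ q') := by
  rcases le_total p.length p'.length with hle | hle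
  · exact word_eq_of_append_eq_of_le hr hr' h hle
  · exact (word_eq_of_append_eq_of_le hr' hr h.symm hle).symm

/-- The word `l` contains a rotation of `a_1 ⋯ a_n` whose deletion leaves a word
representing `m`. -/
def Deletes (l : List (Fin n)) (m : Scyc n) : Prop :=
  ∃ p r q, r ~r List.finRange n ∧ l = p ++ r ++ q ∧ m = word (p ++ q)

theorem Deletes.unique {l : List (Fin n)} {m m' : Scyc n} (h : Deletes l m) (h' : Deletes l m') :
    m = m' := by
  obtain ⟨p, r, q, hr, rfl, rfl⟩ := h
  obtain ⟨p', r', q', hr', h, rfl⟩ := h'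
  exact word_eq_of_append_eq hr hr' h

theorem Deletes.append_left {l : List (Fin n)} {m : Scyc n} (h : Deletes l m)
    (s : List (Fin n)) : Deletes (s ++ l) (word s * m) := by
  obtain ⟨p, r, q, hr, rfl, rfl⟩ := h
  exact ⟨s ++ p, r, q, hr, by simp, by simp [word_append]⟩

theorem Deletes.append_right {l : List (Fin n)} {m : Scyc n} (h : Deletes l m)
    (s : List (Fin n)) : Deletes (l ++ s) (m * word s) := by
  obtain ⟨p, r, q, hr, rfl, rfl⟩ := h
  exact ⟨p, r, q ++ s, hr, by simp, by simp [word_append, mul_assoc]⟩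

/-- Two words are related if they are equal or if deleting rotations of `a_1 ⋯ a_n` from them
gives the same element of `S_n`. -/
def deletionCon (n : ℕ) : Con (FreeMonoid (Fin n)) where
  r x y := x = y ∨ ∃ m, Deletes x.toList m ∧ Deletes y.toList m
  iseqv :=
    { refl := fun _ => Or.inl rfl
      symm := by
        rintro x y (h | ⟨m, h, h'⟩)
        · exact Or.inl h.symm
        · exact Or.inr ⟨m, h', h⟩
      trans := by
        rintro x y z (rfl | ⟨m, h1, h2⟩) (rfl | ⟨m', h3, h4⟩)
        · exact Or.inl rfl
        · exact Or.inr ⟨m', h3, h4⟩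
        · exact Or.inr ⟨m, h1, h2⟩
        · obtain rfl := h2.unique h3
          exact Or.inr ⟨m, h1, h4⟩ }
  mul' := by
    rintro w x y z (rfl | ⟨m, h1, h2⟩) (rfl | ⟨m', h3, h4⟩)
    · exact Or.inl rfl
    · exact Or.inr ⟨_, h3.append_left w.toList, h4.append_left w.toList⟩
    · exact Or.inr ⟨_, h1.append_right y.toList, h2.append_right y.toList⟩
    · have hxy : m * word y.toList = word x.toList * m' :=
        (h2.append_right y.toList).unique (h3.append_left x.toList)
      exact Or.inr ⟨_, h1.append_right y.toList, hxy ▸ h4.append_left x.toList⟩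

theorem deletionCon_of_mk_eq {x y : FreeMonoid (Fin n)}
    (h : (conGen (cycRel n)).mk' x = (conGen (cycRel n)).mk' y) : deletionCon n x y := by
  have h' : conGen (cycRel n) x y := (Con.eq _).1 h
  refine Con.conGen_le.2 ?_ h'
  rintro x y ⟨rfl, k, rfl⟩
  refine Or.inr ⟨1, ⟨[], _, [], ?_, (by simp; rfl), rfl⟩, ⟨[], _, [], ?_, (by simp; rfl), rfl⟩⟩
  · simp [permWord_eq_ofList, List.IsRotated.refl]
  · simp only [permWord_eq_ofList, FreeMonoid.toList_ofList, map_finRotate_pow_finRange]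
    exact List.IsRotated.forall _ _

theorem zc_mul_cancel {x y : Scyc n} (h : zc n * x = zc n * y) : x = y := by
  obtain ⟨l, rfl⟩ := word_surjective x
  obtain ⟨l', rfl⟩ := word_surjective y
  rw [← word_eq_zc (List.IsRotated.refl _), ← word_append, ← word_append] at h
  have hd (s : List (Fin n)) : Deletes (List.finRange n ++ s) (word s) :=
    ⟨[], _, s, List.IsRotated.refl _, rfl, rfl⟩
  rcases deletionCon_of_mk_eq (x := FreeMonoid.ofList (List.finRange n ++ l))
    (y := FreeMonoid.ofList (List.finRange n ++ l')) (by rw [mk_eq_word, mk_eq_word]; exact h)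
    with h | ⟨m, h1, h2⟩
  · rw [List.append_cancel_left (FreeMonoid.ofList.injective h)]
  · exact ((hd l).unique h1).trans (h2.unique (hd l'))

/-- The powers of the central element form an Ore set. -/
instance oreSetPowersZc : OreLocalization.OreSet (Submonoid.powers (zc n)) where
  ore_right_cancel := by
    rintro r₁ r₂ ⟨_, k, rfl⟩ h
    refine ⟨⟨_, k, rfl⟩, ?_⟩
    exact ((((zc_commute r₁).pow_left k).eq.trans h).trans ((zc_commute r₂).pow_left k).eq.symm)
  oreNum r _ := r
  oreDenom _ s := s
  ore_eq := by
    rintro r ⟨_, k, rfl⟩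
    exact ((zc_commute r).pow_left k).eq

/-- `S_n` with the central element inverted. -/
abbrev Loc (n : ℕ) : Type := OreLocalization (Submonoid.powers (zc n)) (Scyc n)

/-- The canonical map from `S_n` to its localization. -/
noncomputable def toLoc (n : ℕ) : Scyc n →* Loc n := OreLocalization.numeratorHom

theorem zc_pow_mul_cancel (k : ℕ) {x y : Scyc n} (h : zc n ^ k * x = zc n ^ k * y) : x = y := by
  induction k with
  | zero => simpa using h
  | succ k ih =>
    rw [pow_succ', mul_assoc, mul_assoc] at h
    exact ih (zc_mul_cancel h)

theorem toLoc_injective : Function.Injective (toLoc n) := by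
  intro x y h
  obtain ⟨⟨_, k, rfl⟩, v, h1, h2⟩ := OreLocalization.oreDiv_eq_iff.1 h
  simp only [Submonoid.coe_one, mul_one] at h2
  subst h2
  exact (zc_pow_mul_cancel k h1).symm

theorem isUnit_toLoc_zc : IsUnit (toLoc n (zc n)) :=
  OreLocalization.numerator_isUnit (⟨zc n, Submonoid.mem_powers _⟩ : Submonoid.powers (zc n))

theorem isUnit_toLoc_agen (i : Fin n) : IsUnit (toLoc n (agen i)) := by
  obtain ⟨t, h1, h2⟩ := exists_inverse_mod_zc i
  refine isUnit_iff_exists_and_exists.2 ?_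
  obtain ⟨u, hu⟩ := isUnit_toLoc_zc (n := n)
  refine ⟨⟨toLoc n t * ↑u⁻¹, ?_⟩, ⟨↑u⁻¹ * toLoc n t, ?_⟩⟩
  · rw [← mul_assoc, ← map_mul, h1, ← hu, Units.mul_inv]
  · rw [mul_assoc, ← map_mul, h2, ← hu, Units.inv_mul]

/-! ### Embedding in the product of a free group and `ℕ` -/

/-- The homomorphism out of `S_n` determined by images of the generators. -/
def lift {M : Type*} [Monoid M] (f : Fin n → M)
    (hf : ∀ r, r ~r List.finRange n → (r.map f).prod = ((List.finRange n).map f).prod) :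
    Scyc n →* M :=
  Con.lift _ (FreeMonoid.lift f) <| Con.conGen_le.2 <| by
    rintro x y ⟨rfl, k, rfl⟩
    rw [Con.ker_rel]
    simp only [permWord_eq_ofList, FreeMonoid.lift_apply, FreeMonoid.toList_ofList,
      map_finRotate_pow_finRange]
    rw [hf _ (List.IsRotated.forall _ _)]
    simp

theorem lift_agen {M : Type*} [Monoid M] (f : Fin n → M)
    (hf : ∀ r, r ~r List.finRange n → (r.map f).prod = ((List.finRange n).map f).prod)
    (i : Fin n) : lift f hf (agen i) = f i :=
  FreeMonoid.lift_eval_of f i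

/-- The image of `a_1 ⋯ a_m` in the free group. -/
def initProd (m : ℕ) : FreeGroup (Fin m) := ((List.finRange m).map FreeGroup.of).prod

/-- The homomorphism from `S_{m+1}` to the free group on `m` generators killing the central
element. -/
def toFree (m : ℕ) : Scyc (m + 1) →* FreeGroup (Fin m) :=
  lift (Fin.lastCases (initProd m)⁻¹ FreeGroup.of) <| by
    intro r hr
    have h1 : ((List.finRange (m + 1)).map
        (Fin.lastCases (motive := fun _ => FreeGroup (Fin m)) (initProd m)⁻¹ FreeGroup.of)).prod
          = 1 := by
      rw [List.finRange_succ_last]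
      simp [Function.comp_def, initProd]
    rw [h1]
    obtain ⟨k, rfl⟩ := hr.symm
    rw [List.map_rotate, List.prod_rotate_eq_one_of_prod_eq_one h1]

/-- The homomorphism from `S_{m+1}` to `ℕ` counting occurrences of the last generator. -/
def lastCount (m : ℕ) : Scyc (m + 1) →* Multiplicative ℕ :=
  lift (Fin.lastCases (Multiplicative.ofAdd 1) fun _ => 1) fun _ hr =>
    (hr.perm.map _).prod_eq

theorem exists_hom_toLoc_eq (m : ℕ) : ∃ ψ : FreeGroup (Fin m) →* (Loc (m + 1))ˣ, ∀ x,
    toLoc (m + 1) x = ψ (toFree m x) * toLoc (m + 1) (zc (m + 1)) ^ (lastCount m x).toAdd := by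
  let ψ : FreeGroup (Fin m) →* (Loc (m + 1))ˣ :=
    FreeGroup.lift fun i => (isUnit_toLoc_agen i.castSucc).unit
  refine ⟨ψ, fun x => ?_⟩
  have hψ (i : Fin m) : (ψ (FreeGroup.of i) : Loc (m + 1)) = toLoc (m + 1) (agen i.castSucc) := by
    simp [ψ]
  have hP : toLoc (m + 1) (zc (m + 1)) =
      ψ (initProd m) * toLoc (m + 1) (agen (Fin.last m)) := by
    have : (ψ (initProd m) : Loc (m + 1)) =
        toLoc (m + 1) ((List.finRange m).map fun i => agen i.castSucc).prod := by
      rw [initProd, map_list_prod, ← Units.coeHom_apply, map_list_prod, map_list_prod,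
        List.map_map, List.map_map, List.map_map]
      congr 1
      exact List.map_congr_left fun i _ => hψ i
    rw [this, ← map_mul]
    refine congrArg _ ?_
    rw [zc, List.finRange_succ_last]
    simp [Function.comp_def]
  obtain ⟨l, rfl⟩ := word_surjective x
  induction l with
  | nil => simp [word]
  | cons i l ih =>
    rw [show word (i :: l) = agen i * word l by simp [word], map_mul, map_mul, map_mul, map_mul]
    have hfree : toFree m (agen i) =
        (Fin.lastCases (initProd m)⁻¹ FreeGroup.of i : FreeGroup (Fin m)) := lift_agen _ _ i
    have hcount : lastCount m (agen i) =
        (Fin.lastCases (Multiplicative.ofAdd 1) (fun _ => 1) i : Multiplicative ℕ) :=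
      lift_agen _ _ i
    rw [hfree, hcount]
    induction i using Fin.lastCases with
    | cast i =>
      rw [ih]
      simp [hψ, mul_assoc]
    | last =>
      have hz : toLoc (m + 1) (agen (Fin.last m)) =
          ↑(ψ (initProd m))⁻¹ * toLoc (m + 1) (zc (m + 1)) := by
        rw [hP, Units.inv_mul_cancel_left]
      rw [hz, mul_assoc, ← map_mul, (zc_commute (word l)).eq, map_mul, ih]
      simp [mul_assoc, pow_add, (Commute.pow_self _ _).eq]

theorem toFree_prod_lastCount_injective (m : ℕ) :
    Function.Injective ((toFree m).prod (lastCount m)) := by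
  obtain ⟨ψ, hψ⟩ := exists_hom_toLoc_eq m
  intro x y h
  rw [MonoidHom.prod_apply, MonoidHom.prod_apply, Prod.mk.injEq] at h
  apply toLoc_injective
  rw [hψ x, hψ y, h.1, h.2]

theorem uniqueProds (m : ℕ) : UniqueProds (Scyc (m + 1)) :=
  UniqueProds.of_injective_mulHom ((toFree m).prod (lastCount m)).toMulHom
    (toFree_prod_lastCount_injective m) inferInstance

end Scyc

/-- the monoid algebra `K[S_n]` is a domain (no nonzero zero divisors). -/
theorem domain (K : Type*) [Field K] (n : ℕ) (hn : 3 ≤ n)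
    (x y : MonoidAlgebra K (Scyc n)) (h : x * y = 0) : x = 0 ∨ y = 0 := by
  obtain ⟨m, rfl⟩ : ∃ m, n = m + 1 := ⟨n - 1, by omega⟩
  have := Scyc.uniqueProds m
  exact mul_eq_zero.1 h
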